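/- Let n ≥ 5 be an integer with 4 ∤ n. Then there is no 4-(v, n+1, 2) block design with v = n(n−1)/2 + 2. That is, there is no set D of (n+1)-element subsets of a v-element set V such that every 4-element subset of V is contained in exactly 2 members of D. -/

import Mathlib

/-- Counting the pairs `(x, B)` with `x ∉ S` and `insert x S ⊆ B`: if all sets of size `j + 1` have
the same (scaled) number of blocks above them, so do all sets of size `j`. -/
lemma card_filter_superset_mul {V : Type*} [Fintype V] [DecidableEq V] {D : Finset (Finset V)}
    {k j a μ : ℕ} (hD : ∀ B ∈ D, B.card = k)
    (h : ∀ T : Finset V, T.card = j + 1 → a * (D.filter (fun B => T ⊆ B)).card = μ)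
    (S : Finset V) (hS : S.card = j) :
    a * (D.filter (fun B => S ⊆ B)).card * (k - j) = μ * (Fintype.card V - j) := by
  have key : ∑ x ∈ Sᶜ, (D.filter (fun B => insert x S ⊆ B)).card
      = (D.filter (fun B => S ⊆ B)).card * (k - j) := by
    have hsum := Finset.sum_card_bipartiteAbove_eq_sum_card_bipartiteBelow
      (s := Sᶜ) (t := D.filter (fun B => S ⊆ B)) (fun x B => x ∈ B)
    have hbelow : ∀ B ∈ D.filter (fun B => S ⊆ B),
        (Finset.bipartiteBelow (fun x B => x ∈ B) Sᶜ B).card = k - j := by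
      intro B hB
      rw [Finset.mem_filter] at hB
      rw [← hD B hB.1, ← hS, ← Finset.card_sdiff_of_subset hB.2]
      congr 1
      ext x
      simp [Finset.bipartiteBelow, and_comm]
    rw [Finset.sum_congr rfl hbelow, Finset.sum_const, smul_eq_mul] at hsum
    rw [← hsum]
    refine Finset.sum_congr rfl fun x _ => ?_
    congr 1
    ext B
    simp only [Finset.bipartiteAbove, Finset.mem_filter, Finset.insert_subset_iff]
    tauto
  rw [mul_assoc, ← key, Finset.mul_sum, Finset.sum_congr rfl (g := fun _ => μ)]
  · rw [Finset.sum_const, smul_eq_mul, Finset.card_compl, hS, mul_comm]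
  · intro x hx
    exact h _ (by rw [Finset.card_insert_of_notMem (Finset.mem_compl.1 hx), hS])

/-- The binomial moments of the intersection sizes of a set `B` with the blocks of a design. -/
lemma sum_choose_card_inter {V : Type*} [DecidableEq V] {D : Finset (Finset V)}
    {j a μ : ℕ} (h : ∀ S : Finset V, S.card = j → a * (D.filter (fun B => S ⊆ B)).card = μ)
    (B : Finset V) :
    a * ∑ C ∈ D, (B ∩ C).card.choose j = B.card.choose j * μ := by
  have hsum := Finset.sum_card_bipartiteAbove_eq_sum_card_bipartiteBelow
    (s := B.powersetCard j) (t := D) (fun S C => S ⊆ C)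
  have hbelow : ∀ C ∈ D, (Finset.bipartiteBelow (fun S C => S ⊆ C) (B.powersetCard j) C).card
      = (B ∩ C).card.choose j := by
    intro C _
    rw [← Finset.card_powersetCard]
    congr 1
    ext S
    simp only [Finset.bipartiteBelow, Finset.mem_filter, Finset.mem_powersetCard,
      Finset.subset_inter_iff]
    tauto
  rw [← Finset.sum_congr rfl hbelow, ← hsum, Finset.mul_sum,
    Finset.sum_congr rfl (g := fun _ => μ)]
  · rw [Finset.sum_const, smul_eq_mul, Finset.card_powersetCard]
  · intro S hS
    exact h S (Finset.mem_powersetCard.1 hS).2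

lemma cast_choose_two_three_four (i : ℕ) :
    2 * (i.choose 2 : ℤ) = i * (i - 1) ∧ 6 * (i.choose 3 : ℤ) = i * (i - 1) * (i - 2) ∧
      24 * (i.choose 4 : ℤ) = i * (i - 1) * (i - 2) * (i - 3) := by
  have h : ∀ j, (j.factorial : ℤ) * i.choose j = (descPochhammer ℤ j).eval (i : ℤ) := by
    intro j
    rw [descPochhammer_eval_eq_descFactorial, Nat.descFactorial_eq_factorial_mul_choose]
    push_cast
    rfl
  have h2 := h 2
  have h3 := h 3
  have h4 := h 4
  simp [descPochhammer_succ_eval, Nat.factorial] at h2 h3 h4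
  exact ⟨h2, h3, h4⟩

/-- The quadratic annihilating the intersection sizes of distinct blocks has no integer root. -/
lemma intersection_polynomial_ne_zero {n i : ℤ} (hn : 5 ≤ n) (hi : i ≤ n) :
    (n - 2) * (n + 1) * ((i - 1) * (i - 4)) + 8 * (n + 1 - i) ≠ 0 := by
  intro h
  have hm : 0 < (n - 2) * (n + 1) := by nlinarith
  rcases le_or_gt i 1 with h1 | h1
  · nlinarith [mul_nonneg hm.le (mul_nonneg (sub_nonneg.2 h1) (by linarith : 0 ≤ 4 - i))]
  rcases le_or_gt 4 i with h4 | h4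
  · nlinarith [mul_nonneg hm.le (mul_nonneg (sub_nonneg.2 h1.le) (sub_nonneg.2 h4))]
  have h23 : i = 2 ∨ i = 3 := by omega
  rcases h23 with rfl | rfl
  · have h5 : n * (n - 5) = -2 := by linarith
    nlinarith
  · nlinarith

/-- For `n ≥ 5` with `4 ∤ n`, there is no `4-(v, n+1, 2)` block design with
`v = n(n−1)/2 + 2`. -/
theorem no_design_4_family (n : ℕ) (hn : 5 ≤ n) (hn4 : ¬ (4 ∣ n))
    (V : Type*) [Fintype V] [DecidableEq V]
    (hV : Fintype.card V = n * (n - 1) / 2 + 2) (D : Finset (Finset V))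
    (hblocks : ∀ B ∈ D, B.card = n + 1)
    (hdesign : ∀ T : Finset V, T.card = 4 →
      (D.filter (fun B => T ⊆ B)).card = 2) :
    False := by
  obtain ⟨m, rfl⟩ : ∃ m, n = m + 2 := ⟨n - 2, by omega⟩
  obtain ⟨w, hw⟩ : ∃ w, (m + 2) * (m + 1) = w + w := by
    simpa [Even, mul_comm] using Nat.even_mul_succ_self (m + 1)
  have hv : Fintype.card V = w + 2 := by
    rw [hV, show m + 2 - 1 = m + 1 by omega, hw]
    omega
  have hw1 : 1 ≤ w := by nlinarith
  have l4 : ∀ S : Finset V, S.card = 4 → 1 * (D.filter (fun B => S ⊆ B)).card = 2 := by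
    simpa using hdesign
  have l3 : ∀ S : Finset V, S.card = 3 → 1 * (D.filter (fun B => S ⊆ B)).card = m + 3 := by
    intro S hS
    have h := card_filter_superset_mul hblocks l4 S hS
    rw [hv, show m + 2 + 1 - 3 = m by omega, show w + 2 - 3 = w - 1 by omega] at h
    apply Nat.eq_of_mul_eq_mul_right (show 0 < m by omega)
    zify [hw1] at *
    linarith
  have l2 : ∀ S : Finset V, S.card = 2 →
      2 * (D.filter (fun B => S ⊆ B)).card = (m + 2) * (m + 3) := by
    intro S hS
    have h := card_filter_superset_mul hblocks l3 S hS
    rw [hv, show m + 2 + 1 - 2 = m + 1 by omega, show w + 2 - 2 = w by omega] at h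
    apply Nat.eq_of_mul_eq_mul_right (show 0 < m + 1 by omega)
    linear_combination 2 * h + (m + 3) * hw.symm
  have l1 : ∀ S : Finset V, S.card = 1 →
      2 * (D.filter (fun B => S ⊆ B)).card = (m + 3) * (w + 1) := by
    intro S hS
    have h := card_filter_superset_mul hblocks l2 S hS
    rw [hv, show m + 2 + 1 - 1 = m + 2 by omega, show w + 2 - 1 = w + 1 by omega] at h
    apply Nat.eq_of_mul_eq_mul_right (show 0 < m + 2 by omega)
    linear_combination h
  have l0 : ∀ S : Finset V, S.card = 0 →
      2 * (D.filter (fun B => S ⊆ B)).card = (w + 1) * (w + 2) := by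
    intro S hS
    have h := card_filter_superset_mul hblocks l1 S hS
    rw [hv] at h
    apply Nat.eq_of_mul_eq_mul_right (show 0 < m + 3 by omega)
    simp only [Nat.sub_zero] at h
    linear_combination h
  have hDcard : 2 * D.card = (w + 1) * (w + 2) := by simpa using l0 ∅ rfl
  obtain ⟨B, hB, C, hC, hBC⟩ := Finset.one_lt_card.1 (show 1 < D.card by nlinarith)
  have s0 := sum_choose_card_inter l0 B
  have s1 := sum_choose_card_inter l1 B
  have s2 := sum_choose_card_inter l2 B
  have s3 := sum_choose_card_inter l3 B
  have s4 := sum_choose_card_inter l4 B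
  rw [hblocks B hB] at s0 s1 s2 s3 s4
  obtain ⟨c2, c3, c4⟩ := cast_choose_two_three_four (m + 2 + 1)
  let M : ℤ := m * (m + 3)
  let S : ℤ := 5 * M + 8
  let P : ℤ := 4 * M + 8 * (m + 3)
  let f : ℕ → ℤ := fun i => M * i ^ 2 - S * i + P
  have hexp : ∀ i : ℕ, f i ^ 2 = 24 * M ^ 2 * i.choose 4 + 6 * (6 * M ^ 2 - 2 * M * S) * i.choose 3
      + 2 * (7 * M ^ 2 - 6 * M * S + S ^ 2 + 2 * M * P) * i.choose 2
      + (M ^ 2 - 2 * M * S + S ^ 2 + 2 * M * P - 2 * S * P) * i.choose 1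
      + P ^ 2 * i.choose 0 := by
    intro i
    obtain ⟨h2, h3, h4⟩ := cast_choose_two_three_four i
    simp only [f, Nat.choose_one_right, Nat.choose_zero_right, Nat.cast_one]
    linear_combination -M ^ 2 * h4 - (6 * M ^ 2 - 2 * M * S) * h3
      - (7 * M ^ 2 - 6 * M * S + S ^ 2 + 2 * M * P) * h2
  have htotal : ∑ C ∈ D, f (B ∩ C).card ^ 2 = f (m + 2 + 1) ^ 2 := by
    simp only [hexp (Finset.card _), Finset.sum_add_distrib, ← Finset.mul_sum]
    have hw' : (w : ℚ) = (m + 2) * (m + 1) / 2 := by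
      have : ((m + 2) * (m + 1) : ℚ) = w + w := mod_cast hw
      linarith
    simp only [f, S, P, M]
    rw [Nat.choose_one_right] at s1
    rw [Nat.choose_zero_right] at s0
    zify at s0 s1 s2 s3 s4
    push_cast at c2 c3 c4
    qify at s0 s1 s2 s3 s4 c2 c3 c4 ⊢
    generalize (∑ C ∈ D, ((B ∩ C).card.choose 0 : ℚ)) = t0 at *
    generalize (∑ C ∈ D, ((B ∩ C).card.choose 1 : ℚ)) = t1 at *
    generalize (∑ C ∈ D, ((B ∩ C).card.choose 2 : ℚ)) = t2 at *
    generalize (∑ C ∈ D, ((B ∩ C).card.choose 3 : ℚ)) = t3 at *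
    generalize (∑ C ∈ D, ((B ∩ C).card.choose 4 : ℚ)) = t4 at *
    obtain rfl : t0 = (w + 1) * (w + 2) / 2 := by linarith
    obtain rfl : t1 = (m + 3) * ((m + 3) * (w + 1)) / 2 := by linarith
    obtain rfl : t2 = (m + 3) * (m + 2) * ((m + 2) * (m + 3)) / 4 := by
      linear_combination s2 / 2 + (m + 2) * (m + 3) * c2 / 4
    obtain rfl : t3 = (m + 3) * (m + 2) * (m + 1) * (m + 3) / 6 := by
      linear_combination s3 + (m + 3) * c3 / 6
    obtain rfl : t4 = (m + 3) * (m + 2) * (m + 1) * m * 2 / 24 := by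
      linear_combination s4 + 2 * c4 / 24
    rw [hw']
    ring
  have hrest : ∑ C ∈ D.erase B, f (B ∩ C).card ^ 2 = 0 := by
    rw [← Finset.add_sum_erase D _ hB, Finset.inter_self, hblocks B hB] at htotal
    linarith
  have hzero := (Finset.sum_eq_zero_iff_of_nonneg fun _ _ => sq_nonneg _).1 hrest C
    (Finset.mem_erase.2 ⟨hBC.symm, hC⟩)
  have hlt : (B ∩ C).card < m + 2 + 1 := by
    rw [← hblocks B hB]
    refine Finset.card_lt_card (Finset.inter_subset_left.ssubset_of_ne fun h => hBC ?_)
    exact Finset.eq_of_subset_of_card_le (Finset.inter_eq_left.1 h)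
      (by rw [hblocks B hB, hblocks C hC])
  refine intersection_polynomial_ne_zero (n := m + 2) (i := (B ∩ C).card) (by omega) (by omega) ?_
  have hroot : f (B ∩ C).card = 0 := pow_eq_zero_iff two_ne_zero |>.1 hzero
  simp only [f, S, P, M] at hroot
  linear_combination hroot
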